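/- arXiv:2409.18748 — 2 statements merged into one kernel-verified Lean document; each statement's English description precedes it below -/
import Mathlib

section
/- Let $A$ be a real $m \times n$ matrix, $b \in \mathbb{R}^m$, and $\gamma > 0$. Suppose $x \ne 0$ is a local minimizer of $F(y) = \gamma \|y\|_1/\|y\|_2 + \tfrac12 \|A y - b\|_2^2$ on $\mathbb{R}^n \setminus \{0\}$. Then $\langle A x, A x - b \rangle = 0$, and consequently $\|A x\|_2 \le \|b\|_2$. -/
/-- The ratio of the `ℓ¹` and `ℓ²` norms is invariant under positive scaling. -/
theorem sum_abs_div_sqrt_sum_sq_smul {ι : Type*} [Fintype ι] (y : ι → ℝ) {t : ℝ} (ht : 0 < t) :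
    (∑ i, |(t • y) i|) / √(∑ i, ((t • y) i) ^ 2) = (∑ i, |y i|) / √(∑ i, (y i) ^ 2) := by
  simp only [Pi.smul_apply, smul_eq_mul, abs_mul, abs_of_pos ht, mul_pow, ← Finset.mul_sum]
  rw [Real.sqrt_mul (sq_nonneg t), Real.sqrt_sq ht.le, mul_div_mul_left _ _ ht.ne']

/-- If scaling `u` does not locally decrease the squared distance to `b`, then `u` is orthogonal
to the residual `u - b`. -/
theorem sum_mul_sub_eq_zero_of_isLocalMin {κ : Type*} [Fintype κ] (u b : κ → ℝ)
    (h : IsLocalMin (fun t : ℝ => ∑ k, (t * u k - b k) ^ 2) 1) :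
    ∑ k, u k * (u k - b k) = 0 := by
  have hd : HasDerivAt (fun t : ℝ => ∑ k, (t * u k - b k) ^ 2)
      (∑ k, 2 * (u k * (u k - b k))) 1 := by
    refine HasDerivAt.fun_sum fun k _ => ?_
    refine ((((hasDerivAt_id' (1 : ℝ)).mul_const (u k)).sub_const (b k)).fun_pow 2).congr_deriv ?_
    norm_num
    ring
  have h0 := h.hasDerivAt_eq_zero hd
  rw [← Finset.mul_sum] at h0
  linarith

/-- A vector orthogonal to its residual `u - b` is no longer than `b`. -/
theorem sum_sq_le_sum_sq_of_sum_mul_sub_eq_zero {κ : Type*} [Fintype κ] (u b : κ → ℝ)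
    (h : ∑ k, u k * (u k - b k) = 0) : ∑ k, u k ^ 2 ≤ ∑ k, b k ^ 2 := by
  have key : ∑ k, b k ^ 2 =
      ∑ k, u k ^ 2 + ∑ k, (u k - b k) ^ 2 - 2 * ∑ k, u k * (u k - b k) := by
    rw [Finset.mul_sum, ← Finset.sum_add_distrib, ← Finset.sum_sub_distrib]
    exact Finset.sum_congr rfl fun k _ => by ring
  have hr : 0 ≤ ∑ k, (u k - b k) ^ 2 := Finset.sum_nonneg fun k _ => sq_nonneg _
  linarith

theorem unconstrained_local_min_residual_orth (m n : ℕ) (A : Matrix (Fin m) (Fin n) ℝ)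
    (b : Fin m → ℝ) (γ : ℝ) (hγ : 0 < γ)
    (x : Fin n → ℝ) (hx : x ≠ 0)
    (hloc : IsLocalMinOn
      (fun y : Fin n → ℝ =>
        γ * ((∑ i, |y i|) / Real.sqrt (∑ i, (y i) ^ 2)) +
          (1 / 2) * ∑ k, (A.mulVec y k - b k) ^ 2)
      {y : Fin n → ℝ | y ≠ 0} x) :
    (∑ k, A.mulVec x k * (A.mulVec x k - b k)) = 0 ∧
    Real.sqrt (∑ k, (A.mulVec x k) ^ 2) ≤ Real.sqrt (∑ k, (b k) ^ 2) := by
  have horth : ∑ k, A.mulVec x k * (A.mulVec x k - b k) = 0 := by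
    refine sum_mul_sub_eq_zero_of_isLocalMin (A.mulVec x) b ?_
    have hpos : ∀ᶠ t : ℝ in nhds 1, 0 < t := lt_mem_nhds one_pos
    have hray : Filter.Tendsto (fun t : ℝ => t • x) (nhds 1) (nhdsWithin x {y | y ≠ 0}) := by
      refine tendsto_nhdsWithin_iff.2 ⟨?_, hpos.mono fun t ht => smul_ne_zero ht.ne' hx⟩
      have hc : Continuous fun t : ℝ => t • x := by fun_prop
      simpa using hc.tendsto 1
    filter_upwards [hray.eventually hloc, hpos] with t hmin ht
    rw [sum_abs_div_sqrt_sum_sq_smul x ht] at hmin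
    simp only [Matrix.mulVec_smul, Pi.smul_apply, smul_eq_mul] at hmin
    simp only [one_mul]
    linarith
  exact ⟨horth, Real.sqrt_le_sqrt (sum_sq_le_sum_sq_of_sum_mul_sub_eq_zero _ _ horth)⟩
end

section
/- Let $A$ be a real $m \times n$ matrix with columns $A_{\cdot i}$, let $b \in \mathbb{R}^m$, and $\gamma > 0$. Suppose $x \ne 0$ is a local minimizer of $F(y) = \gamma \|y\|_1/\|y\|_2 + \tfrac12 \|A y - b\|_2^2$ on $\mathbb{R}^n \setminus \{0\}$. Set $a = \|x\|_1$, $r = \|x\|_2$, and for $i$ with $x_i \ne 0$ set $\tilde{\delta}_i = \|A_{\cdot i}\|_2^2/\gamma$, $\Delta_i = \dfrac{4}{r^6} + \dfrac{12 a^2}{r^8} - \dfrac{12 a \tilde{\delta}_i}{r^5}$, and $\kappa_{2,i} = \dfrac{\frac{2}{r^3} + \sqrt{\Delta_i}}{\frac{6a}{r^5}}$. Then for every index $i$ with $x_i \ne 0$ satisfying $\tilde{\delta}_i \le \dfrac{a}{r^3}$, one has $|x_i| \ge \kappa_{2,i}$. -/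
open Filter Topology

/-- The second-order necessary condition for a local minimum of a real function. -/
theorem IsLocalMin.second_deriv_nonneg {f f' : ℝ → ℝ} {c x₀ : ℝ} (hmin : IsLocalMin f x₀)
    (hf : ∀ᶠ s in 𝓝 x₀, HasDerivAt f (f' s) s) (hf' : HasDerivAt f' c x₀) : 0 ≤ c := by
  by_contra! hc
  have hψ : ∀ᶠ s in 𝓝 x₀, HasDerivAt (fun s => f s - c / 4 * (s - x₀) ^ 2)
      (f' s - c / 2 * (s - x₀)) s := by
    filter_upwards [hf] with s hs
    have h := hs.sub ((((hasDerivAt_id s).sub_const x₀).pow 2).const_mul (c / 4))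
    refine h.congr_deriv ?_
    simp
    ring
  have hderiv : deriv (fun s => f s - c / 4 * (s - x₀) ^ 2) =ᶠ[𝓝 x₀]
      fun s => f' s - c / 2 * (s - x₀) := by
    filter_upwards [hψ] with s hs using hs.deriv
  have hψ' : HasDerivAt (fun s => f' s - c / 2 * (s - x₀)) (c / 2) x₀ := by
    refine (hf'.sub (((hasDerivAt_id x₀).sub_const x₀).const_mul (c / 2))).congr_deriv ?_
    ring
  have hcrit : f' x₀ = 0 := hmin.hasDerivAt_eq_zero hf.self_of_nhds
  have hmax : IsLocalMax (fun s => f s - c / 4 * (s - x₀) ^ 2) x₀ := by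
    refine isLocalMax_of_deriv_deriv_neg ?_ ?_ hψ.self_of_nhds.continuousAt
    · rw [hderiv.deriv_eq, hψ'.deriv]
      linarith
    · simp [hderiv.self_of_nhds, hcrit]
  have heq : ∀ᶠ s in 𝓝 x₀, s = x₀ := by
    filter_upwards [hmin, hmax] with s h₁ h₂
    simp only [sub_self] at h₂
    have : (s - x₀) ^ 2 ≤ 0 := by nlinarith [sq_nonneg (s - x₀)]
    exact sub_eq_zero.mp (pow_eq_zero_iff two_ne_zero |>.mp (le_antisymm this (sq_nonneg _)))
  obtain ⟨s, hs, hne⟩ := ((heq.filter_mono nhdsWithin_le_nhds).and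
    (self_mem_nhdsWithin : {x₀}ᶜ ∈ 𝓝[≠] x₀)).exists
  exact hne hs

/-- The first derivative of a linear function over the square root of a quadratic one. -/
theorem hasDerivAt_linear_div_sqrt {a u v R s : ℝ} (hq : 0 < R + 2 * v * s + v * s ^ 2) :
    HasDerivAt (fun s => (a + u * s) / √(R + 2 * v * s + v * s ^ 2))
      (u / √(R + 2 * v * s + v * s ^ 2) -
        (a + u * s) * (v * (1 + s)) / √(R + 2 * v * s + v * s ^ 2) ^ 3) s := by
  have hw := Real.sqrt_pos.mpr hq
  have hquad : HasDerivAt (fun s => R + 2 * v * s + v * s ^ 2) (2 * (v * (1 + s))) s := by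
    refine ((((hasDerivAt_id s).const_mul (2 * v)).const_add R).add
      (((hasDerivAt_id s).pow 2).const_mul v)).congr_deriv ?_
    simp
    ring
  refine ((((hasDerivAt_id s).const_mul u).const_add a).div (hquad.sqrt hq.ne')
    hw.ne').congr_deriv ?_
  simp only [id]
  field_simp

/-- The second derivative at `0` of a linear function over the square root of a quadratic one. -/
theorem hasDerivAt_deriv_linear_div_sqrt {a u v r : ℝ} (hr : 0 < r) :
    HasDerivAt (fun s => u / √(r ^ 2 + 2 * v * s + v * s ^ 2) -
        (a + u * s) * (v * (1 + s)) / √(r ^ 2 + 2 * v * s + v * s ^ 2) ^ 3)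
      (-(2 * u * v + a * v) / r ^ 3 + 3 * a * v ^ 2 / r ^ 5) 0 := by
  have hsqrt : √(r ^ 2 + 2 * v * 0 + v * 0 ^ 2) = r := by
    simp [Real.sqrt_sq hr.le]
  have hquad : HasDerivAt (fun s => r ^ 2 + 2 * v * s + v * s ^ 2) (2 * v) 0 := by
    refine ((((hasDerivAt_id 0).const_mul (2 * v)).const_add (r ^ 2)).add
      (((hasDerivAt_id (0 : ℝ)).pow 2).const_mul v)).congr_deriv ?_
    simp
  have hw : HasDerivAt (fun s => √(r ^ 2 + 2 * v * s + v * s ^ 2)) (v / r) 0 := by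
    refine (hquad.sqrt (by simp [hr.ne'])).congr_deriv ?_
    rw [hsqrt]
    field_simp
  have hnum : HasDerivAt (fun s => (a + u * s) * (v * (1 + s))) (u * v + a * v) 0 := by
    refine ((((hasDerivAt_id (0 : ℝ)).const_mul u).const_add a).mul
      (((hasDerivAt_id (0 : ℝ)).const_add 1).const_mul v)).congr_deriv ?_
    simp
  refine (((hasDerivAt_const (0 : ℝ) u).div hw (by rw [hsqrt]; exact hr.ne')).sub
    (hnum.div (hw.pow 3) ?_)).congr_deriv ?_
  · simp only [Pi.pow_apply, hsqrt]
    positivity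
  · simp only [Pi.pow_apply, hsqrt]
    field_simp
    ring

/-- The second-order necessary condition along coordinate `i`, at a local minimizer of
`γ ‖y‖₁ / ‖y‖₂ + ‖A y - b‖₂² / 2`. -/
theorem coordinate_second_order_condition {m n : ℕ} {A : Matrix (Fin m) (Fin n) ℝ}
    {b : Fin m → ℝ} {γ : ℝ} {x : Fin n → ℝ} (hx : x ≠ 0)
    (hloc : IsLocalMinOn
      (fun y : Fin n → ℝ =>
        γ * ((∑ i, |y i|) / Real.sqrt (∑ i, (y i) ^ 2)) +
          (1 / 2) * ∑ k, (A.mulVec y k - b k) ^ 2)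
      {y : Fin n → ℝ | y ≠ 0} x)
    {a r : ℝ} (ha : a = ∑ i, |x i|) (hr : r = Real.sqrt (∑ i, (x i) ^ 2)) (hr₀ : 0 < r)
    {i : Fin n} (hi : x i ≠ 0) :
    0 ≤ γ * (-(2 * |x i| + a) / r ^ 3 + 3 * a * |x i| ^ 2 / r ^ 5) + ∑ k, (A k i) ^ 2 := by
  have hu : 0 < |x i| := abs_pos.mpr hi
  have hr₂ : r ^ 2 = ∑ j, (x j) ^ 2 := by
    rw [hr, Real.sq_sqrt (Finset.sum_nonneg fun j _ => sq_nonneg _)]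
  set y : ℝ → Fin n → ℝ := fun s => x + Pi.single i (x i * s) with hy
  have hy₀ : y 0 = x := by simp [hy]
  have hyc : Continuous y := by
    refine continuous_const.add ((continuous_single i).comp ?_)
    fun_prop
  have habs : ∀ s, -1 < s → ∑ j, |y s j| = a + |x i| * s := by
    intro s hs
    have hterm : ∀ j, |y s j| = |x j| + (Pi.single i (|x i| * s) : Fin n → ℝ) j := by
      intro j
      rcases eq_or_ne j i with rfl | hj
      · simp only [hy, Pi.add_apply, Pi.single_eq_same]
        rw [show x j + x j * s = x j * (1 + s) by ring, abs_mul,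
          abs_of_pos (show 0 < 1 + s by linarith)]
        ring
      · simp [hy, hj]
    simp [hterm, Finset.sum_add_distrib, ha]
  have hsq : ∀ s, ∑ j, (y s j) ^ 2 = r ^ 2 + 2 * |x i| ^ 2 * s + |x i| ^ 2 * s ^ 2 := by
    intro s
    have hterm : ∀ j, (y s j) ^ 2 = (x j) ^ 2 +
        (Pi.single i (2 * |x i| ^ 2 * s + |x i| ^ 2 * s ^ 2) : Fin n → ℝ) j := by
      intro j
      rcases eq_or_ne j i with rfl | hj
      · simp only [hy, Pi.add_apply, Pi.single_eq_same, sq_abs]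
        ring
      · simp [hy, hj]
    simp only [hterm, Finset.sum_add_distrib, hr₂, Finset.sum_pi_single', Finset.mem_univ, if_true]
    simp
    ring
  have hres : ∀ s, (1 / 2) * ∑ k, (A.mulVec (y s) k - b k) ^ 2 =
      (1 / 2) * ∑ k, (A.mulVec x k - b k) ^ 2 +
        (∑ k, (A.mulVec x k - b k) * (A k i * x i)) * s +
        |x i| ^ 2 * (∑ k, (A k i) ^ 2) / 2 * s ^ 2 := by
    intro s
    simp only [hy, Matrix.mulVec_add, Matrix.mulVec_single, Pi.add_apply, sq_abs,
      Finset.mul_sum, Finset.sum_mul, Finset.sum_div, ← Finset.sum_add_distrib]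
    refine Finset.sum_congr rfl fun k _ => ?_
    simp
    ring
  set P := (1 / 2) * ∑ k, (A.mulVec x k - b k) ^ 2
  set Q := ∑ k, (A.mulVec x k - b k) * (A k i * x i)
  set D := ∑ k, (A k i) ^ 2
  set u := |x i|
  have hne : ∀ᶠ s in 𝓝 (0 : ℝ), y s ∈ {y : Fin n → ℝ | y ≠ 0} :=
    hyc.continuousAt.eventually_ne (by rwa [hy₀])
  have htend : Tendsto y (𝓝 0) (𝓝[{y : Fin n → ℝ | y ≠ 0}] x) :=
    tendsto_nhdsWithin_iff.mpr ⟨by simpa [hy₀] using hyc.tendsto 0, hne⟩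
  have hs₁ : ∀ᶠ s in 𝓝 (0 : ℝ), -1 < s := lt_mem_nhds (by norm_num)
  have hmin : IsLocalMin (fun s => γ * ((a + u * s) / √(r ^ 2 + 2 * u ^ 2 * s + u ^ 2 * s ^ 2)) +
      (P + Q * s + u ^ 2 * D / 2 * s ^ 2)) 0 := by
    filter_upwards [htend.eventually hloc, hs₁] with s hs h₁
    rw [← hres, ← hres, ← hsq, ← hsq, ← habs s h₁, ← habs 0 (by norm_num), hy₀]
    exact hs
  have hpos : ∀ᶠ s in 𝓝 (0 : ℝ), 0 < r ^ 2 + 2 * u ^ 2 * s + u ^ 2 * s ^ 2 := by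
    have hc : Continuous fun s : ℝ => r ^ 2 + 2 * u ^ 2 * s + u ^ 2 * s ^ 2 := by fun_prop
    exact hc.continuousAt.eventually_const_lt (by simp [hr₀])
  have hderiv : ∀ᶠ s in 𝓝 (0 : ℝ), HasDerivAt
      (fun s => γ * ((a + u * s) / √(r ^ 2 + 2 * u ^ 2 * s + u ^ 2 * s ^ 2)) +
        (P + Q * s + u ^ 2 * D / 2 * s ^ 2))
      (γ * (u / √(r ^ 2 + 2 * u ^ 2 * s + u ^ 2 * s ^ 2) -
        (a + u * s) * (u ^ 2 * (1 + s)) / √(r ^ 2 + 2 * u ^ 2 * s + u ^ 2 * s ^ 2) ^ 3) +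
        (Q + u ^ 2 * D * s)) s := by
    filter_upwards [hpos] with s hs
    refine ((hasDerivAt_linear_div_sqrt hs).const_mul γ).add
      (((((hasDerivAt_id s).const_mul Q).const_add P).add
        (((hasDerivAt_id s).pow 2).const_mul (u ^ 2 * D / 2))).congr_deriv ?_)
    simp
    ring
  have hsecond := hmin.second_deriv_nonneg hderiv
    (((hasDerivAt_deriv_linear_div_sqrt (a := a) (u := u) (v := u ^ 2) hr₀).const_mul γ).add
      (((hasDerivAt_id (0 : ℝ)).const_mul (u ^ 2 * D)).const_add Q))
  refine nonneg_of_mul_nonneg_right (hsecond.trans_eq ?_) (pow_pos hu 2)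
  ring


theorem unconstrained_entry_lower_bound (m n : ℕ) (A : Matrix (Fin m) (Fin n) ℝ)
    (b : Fin m → ℝ) (γ : ℝ) (hγ : 0 < γ)
    (x : Fin n → ℝ) (hx : x ≠ 0)
    (hloc : IsLocalMinOn
      (fun y : Fin n → ℝ =>
        γ * ((∑ i, |y i|) / Real.sqrt (∑ i, (y i) ^ 2)) +
          (1 / 2) * ∑ k, (A.mulVec y k - b k) ^ 2)
      {y : Fin n → ℝ | y ≠ 0} x)
    (a r : ℝ) (ha : a = ∑ i, |x i|) (hr : r = Real.sqrt (∑ i, (x i) ^ 2))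
    (δt : Fin n → ℝ) (hδt : ∀ i, δt i = (∑ k, (A k i) ^ 2) / γ)
    (Δ : Fin n → ℝ)
    (hΔ : ∀ i, Δ i = 4 / r ^ 6 + 12 * a ^ 2 / r ^ 8 - 12 * a * δt i / r ^ 5)
    (κ₂ : Fin n → ℝ)
    (hκ₂ : ∀ i, κ₂ i = (2 / r ^ 3 + Real.sqrt (Δ i)) / (6 * a / r ^ 5)) :
    ∀ i, x i ≠ 0 → δt i ≤ a / r ^ 3 → κ₂ i ≤ |x i| := by
  intro i hi hδ
  have hsum : 0 < ∑ j, (x j) ^ 2 :=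
    Finset.sum_pos' (fun j _ => sq_nonneg _) ⟨i, Finset.mem_univ i, by positivity⟩
  have hr₀ : 0 < r := hr ▸ Real.sqrt_pos.mpr hsum
  have ha₀ : 0 < a := ha ▸
    Finset.sum_pos' (fun j _ => abs_nonneg _) ⟨i, Finset.mem_univ i, abs_pos.mpr hi⟩
  have hu : 0 < |x i| := abs_pos.mpr hi
  have hsecond := coordinate_second_order_condition hx hloc ha hr hr₀ hi
  have hD : ∑ k, (A k i) ^ 2 = γ * δt i := by
    rw [hδt]
    field_simp
  rw [hD, ← mul_add] at hsecond
  have hquad := nonneg_of_mul_nonneg_right hsecond hγ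
  set p := 6 * a / r ^ 5 with hp
  set q := 2 / r ^ 3 with hq
  have hp₀ : 0 < p := by positivity
  have hq₀ : 0 < q := by positivity
  have hc : 0 ≤ a / r ^ 3 - δt i := sub_nonneg.mpr hδ
  have hdisc : Δ i = q ^ 2 + 2 * p * (a / r ^ 3 - δt i) := by
    rw [hΔ, hp, hq]
    field_simp
    ring
  have hquad' : 0 ≤ p / 2 * |x i| ^ 2 - q * |x i| - (a / r ^ 3 - δt i) := by
    refine hquad.trans_eq ?_
    rw [hp, hq]
    ring
  have hdisc_le : Δ i ≤ (p * |x i| - q) ^ 2 := by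
    rw [hdisc]
    nlinarith
  have hlin : 0 ≤ p * |x i| - q := by
    have : 0 ≤ |x i| * (p / 2 * |x i| - q) := by linarith
    have := nonneg_of_mul_nonneg_right this hu
    nlinarith
  rw [hκ₂, div_le_iff₀ hp₀]
  have := Real.sqrt_le_iff.mpr ⟨hlin, hdisc_le⟩
  linarith
end
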